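/- arXiv:2305.05437 — 2 statements merged into one kernel-verified Lean document; each statement's English description precedes it below -/
import Mathlib

section
/- Let u_ε be a classical solution of the regularized isotropic problem with ε ∈ (0,ε₀], satisfying |u_ε| ≤ M on Q̄_T, and suppose F satisfies the monotonicity condition F(x,u,z) ≤ F(x,v,z) whenever u ≥ v. Then for every δ > 0 and all (t,x) ∈ Q̄_T one has the one-sided estimate u_ε(t,x) − u₀(x) ≤ (K₁+δ)t, where K₁ is the constant defined in the context. -/
open Set Filter MeasureTheory Metric

noncomputable section

/-- The `i`-th partial derivative of a function on Euclidean space. -/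
def pd {n : ℕ} (f : EuclideanSpace ℝ (Fin n) → ℝ) (i : Fin n)
    (x : EuclideanSpace ℝ (Fin n)) : ℝ :=
  fderiv ℝ f x (EuclideanSpace.single i 1)

/-- The gradient vector of a function on Euclidean space. -/
def gradv {n : ℕ} (f : EuclideanSpace ℝ (Fin n) → ℝ)
    (x : EuclideanSpace ℝ (Fin n)) : EuclideanSpace ℝ (Fin n) :=
  (WithLp.equiv 2 (Fin n → ℝ)).symm (fun i => pd f i x)

/-- The exterior sphere condition for a domain. -/
def ExteriorSphereCond {n : ℕ} (Ω : Set (EuclideanSpace ℝ (Fin n))) : Prop :=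
  ∀ y ∈ frontier Ω, ∃ z r, 0 < r ∧ closedBall z r ∩ closure Ω = {y}

/-- `f` is of class `C^{1+γ}` on `s` (C¹ with γ-Hölder continuous derivative). -/
def C1HolderOn {n : ℕ} (γ : ℝ) (s : Set (EuclideanSpace ℝ (Fin n)))
    (f : EuclideanSpace ℝ (Fin n) → ℝ) : Prop :=
  ContDiffOn ℝ 1 f s ∧
    ∃ C : NNReal, HolderOnWith C γ.toNNReal (fun x => fderivWithin ℝ f s x) s

/-- Classical solution of the regularized isotropic problem
`u_t = div((|∇u|² + ε)^{p(x)/2} ∇u) + F(x, u, ∇u)` in `Q_T = (0,T) × Ω`,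
with `u = ψ` on `∂Ω × (0,T)` and `u(0,·) = u₀` in `Ω`. -/
structure IsClassicalSolIso {n : ℕ} (Ω : Set (EuclideanSpace ℝ (Fin n))) (T : ℝ)
    (p : EuclideanSpace ℝ (Fin n) → ℝ)
    (F : EuclideanSpace ℝ (Fin n) → ℝ → EuclideanSpace ℝ (Fin n) → ℝ)
    (ψ u₀ : EuclideanSpace ℝ (Fin n) → ℝ) (ε : ℝ)
    (u : ℝ → EuclideanSpace ℝ (Fin n) → ℝ) : Prop where
  cont : ContinuousOn (fun q : ℝ × EuclideanSpace ℝ (Fin n) => u q.1 q.2)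
      (Icc 0 T ×ˢ closure Ω)
  diff_t : ∀ t ∈ Ioo 0 T, ∀ x ∈ Ω, DifferentiableAt ℝ (fun s => u s x) t
  smooth_x : ∀ t ∈ Ioo 0 T, ∀ x ∈ Ω, ContDiffAt ℝ 2 (u t) x
  cont_ut : ContinuousOn
      (fun q : ℝ × EuclideanSpace ℝ (Fin n) => deriv (fun s => u s q.2) q.1) (Ioo 0 T ×ˢ Ω)
  cont_ux : ∀ i, ContinuousOn
      (fun q : ℝ × EuclideanSpace ℝ (Fin n) => pd (u q.1) i q.2) (Ioo 0 T ×ˢ Ω)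
  cont_uxx : ∀ i j, ContinuousOn
      (fun q : ℝ × EuclideanSpace ℝ (Fin n) => pd (fun y => pd (u q.1) j y) i q.2)
      (Ioo 0 T ×ˢ Ω)
  eqn : ∀ t ∈ Ioo 0 T, ∀ x ∈ Ω,
      deriv (fun s => u s x) t =
        (∑ i, pd (fun y => (‖gradv (u t) y‖ ^ 2 + ε) ^ (p y / 2) * pd (u t) i y) i x)
          + F x (u t x) (gradv (u t) x)
  bdry : ∀ t ∈ Ioo 0 T, ∀ x ∈ frontier Ω, u t x = ψ x
  init : ∀ x ∈ closure Ω, u 0 x = u₀ x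

/-- The `j`-th partial derivative of a `C²` function is differentiable, with derivative read off
the second Fréchet derivative. -/
lemma hasFDerivAt_pd {n : ℕ} {f : EuclideanSpace ℝ (Fin n) → ℝ} {x : EuclideanSpace ℝ (Fin n)}
    (hf : ContDiffAt ℝ 2 f x) (j : Fin n) :
    HasFDerivAt (fun y => pd f j y)
      ((fderiv ℝ (fderiv ℝ f) x).flip (EuclideanSpace.single j 1)) x := by
  have h : DifferentiableAt ℝ (fderiv ℝ f) x :=
    (hf.fderiv_right (m := 1) (by norm_num)).differentiableAt (by norm_num)
  refine (h.hasFDerivAt.clm_apply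
    (hasFDerivAt_const (EuclideanSpace.single j (1 : ℝ)) x)).congr_fderiv ?_
  ext v
  simp

lemma norm_gradv_sq {n : ℕ} (f : EuclideanSpace ℝ (Fin n) → ℝ) (x : EuclideanSpace ℝ (Fin n)) :
    ‖gradv f x‖ ^ 2 = ∑ j, pd f j x ^ 2 := by
  simp [EuclideanSpace.real_norm_sq_eq, gradv]

/-- Expansion of the diagonal terms of the divergence of the regularized flux. -/
lemma pd_flux {n : ℕ} {f p : EuclideanSpace ℝ (Fin n) → ℝ} {x : EuclideanSpace ℝ (Fin n)}
    (hf : ContDiffAt ℝ 2 f x) (hp : DifferentiableAt ℝ p x) {ε : ℝ} (hε : 0 < ε) (i : Fin n) :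
    pd (fun y => (‖gradv f y‖ ^ 2 + ε) ^ (p y / 2) * pd f i y) i x =
      (‖gradv f x‖ ^ 2 + ε) ^ (p x / 2) *
        (fderiv ℝ (fderiv ℝ f) x (EuclideanSpace.single i 1) (EuclideanSpace.single i 1) +
          p x / (‖gradv f x‖ ^ 2 + ε) * ∑ j, pd f i x * pd f j x *
            fderiv ℝ (fderiv ℝ f) x (EuclideanSpace.single i 1) (EuclideanSpace.single j 1) +
          pd p i x / 2 * Real.log (‖gradv f x‖ ^ 2 + ε) * pd f i x) := by
  have hs : 0 < ∑ j, pd f j x ^ 2 + ε := by positivity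
  have hS : HasFDerivAt (fun y => ∑ j, pd f j y ^ 2 + ε) _ x :=
    (HasFDerivAt.fun_sum fun j (_ : j ∈ Finset.univ) => (hasFDerivAt_pd hf j).pow 2).add_const ε
  have hq : HasFDerivAt (fun y => p y / 2) _ x := hp.hasFDerivAt.mul_const (2 : ℝ)⁻¹
  have h := (hS.rpow hq hs).mul (hasFDerivAt_pd hf i)
  simp only [norm_gradv_sq]
  have h' := congrArg (fun L => L (EuclideanSpace.single i (1 : ℝ))) h.fderiv
  refine Eq.trans h' ?_
  simp only [Real.rpow_sub_one hs.ne', add_apply,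
    smul_apply, sum_apply,
    ContinuousLinearMap.flip_apply, smul_eq_mul, Finset.mul_sum]
  generalize ∑ j, pd f j x ^ 2 + ε = S
  rw [mul_add, mul_add, mul_add, ← add_assoc]
  simp only [Finset.mul_sum]
  congr 1
  · congr 1
    refine Finset.sum_congr rfl fun j _ => ?_
    simp only [nsmul_eq_mul, Nat.cast_ofNat, Nat.add_one_sub_one, pow_one]
    ring
  · simp only [pd]
    ring

/-- A bilinear form that is nonpositive on the diagonal has nonpositive contraction with
`s I + q z zᵀ` whenever `|z|² ≤ s` and `-1 ≤ q`. -/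
lemma contraction_nonpos {n : ℕ}
    (Q : EuclideanSpace ℝ (Fin n) →L[ℝ] EuclideanSpace ℝ (Fin n) →L[ℝ] ℝ)
    (hQ : ∀ v, Q v v ≤ 0) (z : Fin n → ℝ) {s q : ℝ} (hs : ∑ j, z j ^ 2 ≤ s) (hq : -1 ≤ q) :
    s * ∑ i, Q (EuclideanSpace.single i 1) (EuclideanSpace.single i 1) +
      q * ∑ i, ∑ j, z i * z j * Q (EuclideanSpace.single i 1) (EuclideanSpace.single j 1) ≤ 0 := by
  set H : Fin n → Fin n → ℝ :=
    fun i j => Q (EuclideanSpace.single i 1) (EuclideanSpace.single j 1) with hH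
  have htr : ∑ i, H i i ≤ 0 := Finset.sum_nonpos fun i _ => hQ _
  have hzz : ∑ i, ∑ j, z i * z j * H i j ≤ 0 := by
    have h := hQ (∑ i, z i • EuclideanSpace.single i (1 : ℝ))
    simp only [map_sum, map_smul, sum_apply, smul_apply,
      smul_eq_mul, Finset.mul_sum] at h
    rw [Finset.sum_comm] at h
    simpa only [mul_assoc, mul_left_comm] using h
  have hcs : (∑ j, z j ^ 2) * ∑ i, H i i ≤ ∑ i, ∑ j, z i * z j * H i j := by
    have h : ∑ i, ∑ j, (z j ^ 2 * H i i + z i ^ 2 * H j j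
        - z i * z j * H i j - z j * z i * H j i) ≤ 0 := by
      refine Finset.sum_nonpos fun i _ => Finset.sum_nonpos fun j _ => ?_
      have h := hQ (z j • EuclideanSpace.single i (1 : ℝ) - z i • EuclideanSpace.single j (1 : ℝ))
      simp only [map_sub, map_smul, sub_apply,
        smul_apply, smul_eq_mul] at h
      simp only [hH]
      linarith
    simp only [Finset.sum_add_distrib, Finset.sum_sub_distrib] at h
    rw [Finset.sum_comm (f := fun i j => z j * z i * H j i),
      Finset.sum_comm (f := fun i j => z j ^ 2 * H i i)] at h
    simp only [← Finset.mul_sum, ← Finset.sum_mul] at h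
    linarith
  change s * ∑ i, H i i + q * ∑ i, ∑ j, z i * z j * H i j ≤ 0
  nlinarith

/-- Second-order necessary condition at a local maximum. -/
lemma IsLocalMax.fderiv_fderiv_nonpos {E : Type*} [NormedAddCommGroup E] [NormedSpace ℝ E]
    {h : E → ℝ} {x : E} (hm : IsLocalMax h x) (hh : ContDiffAt ℝ 2 h x) (v : E) :
    fderiv ℝ (fderiv ℝ h) x v v ≤ 0 := by
  by_contra! hpos
  have hl : ∀ s : ℝ, HasDerivAt (fun s : ℝ => x + s • v) v s := fun s => by
    simpa using ((hasDerivAt_id s).smul_const v).const_add x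
  have hl0 : Tendsto (fun s : ℝ => x + s • v) (nhds 0) (nhds x) := by
    simpa using (hl 0).continuousAt.tendsto
  have hd : ∀ᶠ y in nhds x, DifferentiableAt ℝ h y :=
    (hh.eventually (by simp)).mono fun y hy => hy.differentiableAt (by norm_num)
  have hd1 : deriv (fun s : ℝ => h (x + s • v)) =ᶠ[nhds 0] fun s => fderiv ℝ h (x + s • v) v :=
    (hl0.eventually hd).mono fun s hs => (hs.hasFDerivAt.comp_hasDerivAt s (hl s)).deriv
  have h2 : DifferentiableAt ℝ (fderiv ℝ h) (x + (0 : ℝ) • v) := by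
    simpa using (hh.fderiv_right (m := 1) (by norm_num)).differentiableAt (by norm_num)
  have hd2 : deriv (deriv fun s : ℝ => h (x + s • v)) 0 = fderiv ℝ (fderiv ℝ h) x v v := by
    rw [hd1.deriv_eq]
    have h3 : HasDerivAt (fun s : ℝ => fderiv ℝ h (x + s • v))
        (fderiv ℝ (fderiv ℝ h) (x + (0 : ℝ) • v) v) 0 :=
      h2.hasFDerivAt.comp_hasDerivAt (f := fun s : ℝ => x + s • v) 0 (hl 0)
    have h4 := (h3.clm_apply (hasDerivAt_const (0 : ℝ) v)).deriv
    simpa using h4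
  have hmax : IsLocalMax (fun s : ℝ => h (x + s • v)) 0 := by
    simpa [IsLocalMax, IsMaxFilter] using hl0.eventually hm
  have hmin : IsLocalMin (fun s : ℝ => h (x + s • v)) 0 := by
    refine isLocalMin_of_deriv_deriv_pos (hd2 ▸ hpos) hmax.deriv_eq_zero ?_
    have hc : ContinuousAt h (x + (0 : ℝ) • v) := by simpa using hh.continuousAt
    exact ContinuousAt.comp (f := fun s : ℝ => x + s • v) hc (hl 0).continuousAt
  have hconst : (fun s : ℝ => h (x + s • v)) =ᶠ[nhds 0] fun _ => h (x + (0 : ℝ) • v) :=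
    (hmax.and hmin).mono fun s hs => le_antisymm hs.1 hs.2
  have h0 := hconst.deriv.deriv_eq
  rw [hd2] at h0
  simp at h0
  exact hpos.ne' h0

/-- A function dominated on the left of `t` by its value at `t` has nonnegative derivative. -/
lemma HasDerivAt.nonneg_of_le_left {f : ℝ → ℝ} {f' a t : ℝ} (hf : HasDerivAt f f' t) (ha : a < t)
    (hle : ∀ s ∈ Ioo a t, f s ≤ f t) : 0 ≤ f' := by
  have h := (hasDerivAt_iff_tendsto_slope.1 hf).mono_left
    (nhdsWithin_mono t fun s (hs : s ∈ Iio t) => ne_of_lt hs)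
  refine ge_of_tendsto h ?_
  filter_upwards [Ioo_mem_nhdsLT ha] with s hs
  rw [slope_def_field]
  exact div_nonneg_of_nonpos (sub_nonpos.2 (hle s hs)) (sub_nonpos.2 hs.2.le)

/-- Comparison of the regularized diffusion operator at a local maximum of a difference. -/
lemma div_flux_le {n : ℕ} {f g p : EuclideanSpace ℝ (Fin n) → ℝ} {x : EuclideanSpace ℝ (Fin n)}
    (hf : ContDiffAt ℝ 2 f x) (hg : ContDiffAt ℝ 2 g x) (hp : DifferentiableAt ℝ p x)
    (hp1 : -1 ≤ p x) {ε : ℝ} (hε : 0 < ε) (hm : IsLocalMax (fun y => f y - g y) x) :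
    gradv f x = gradv g x ∧
    ∑ i, pd (fun y => (‖gradv f y‖ ^ 2 + ε) ^ (p y / 2) * pd f i y) i x ≤
      ∑ i, pd (fun y => (‖gradv g y‖ ^ 2 + ε) ^ (p y / 2) * pd g i y) i x := by
  have hdf : ∀ᶠ y in nhds x, DifferentiableAt ℝ f y :=
    (hf.eventually (by norm_num)).mono fun y hy => hy.differentiableAt (by norm_num)
  have hdg : ∀ᶠ y in nhds x, DifferentiableAt ℝ g y :=
    (hg.eventually (by norm_num)).mono fun y hy => hy.differentiableAt (by norm_num)
  have hsub : fderiv ℝ (fun y => f y - g y) =ᶠ[nhds x] fun y => fderiv ℝ f y - fderiv ℝ g y := by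
    filter_upwards [hdf, hdg] with y h1 h2 using fderiv_fun_sub h1 h2
  have hpd : ∀ i, pd f i x = pd g i x := fun i => by
    have h := hsub.eq_of_nhds.symm.trans hm.fderiv_eq_zero
    simp only [pd, sub_eq_zero.1 h]
  have hgrad : gradv f x = gradv g x := by simp only [gradv, hpd]
  refine ⟨hgrad, ?_⟩
  have hQ : ∀ v, (fderiv ℝ (fderiv ℝ f) x - fderiv ℝ (fderiv ℝ g) x) v v ≤ 0 := fun v => by
    have h := hm.fderiv_fderiv_nonpos (hf.sub hg) v
    rwa [hsub.fderiv_eq, fderiv_fun_sub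
      ((hf.fderiv_right (m := 1) (by norm_num)).differentiableAt (by norm_num))
      ((hg.fderiv_right (m := 1) (by norm_num)).differentiableAt (by norm_num))] at h
  have hs : 0 < ‖gradv g x‖ ^ 2 + ε := by positivity
  have hc := contraction_nonpos _ hQ (fun i => pd g i x) (s := ‖gradv g x‖ ^ 2 + ε)
    (by rw [norm_gradv_sq]; linarith) hp1
  rw [← sub_nonpos, ← Finset.sum_sub_distrib]
  simp only [pd_flux hf hp hε, pd_flux hg hp hε, hgrad, hpd]
  set s := ‖gradv g x‖ ^ 2 + ε
  have hG : 0 < s ^ (p x / 2) := Real.rpow_pos_of_pos hs _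
  refine le_of_eq_of_le ?_ (mul_nonpos_of_nonneg_of_nonpos (div_pos hG hs).le hc)
  simp only [sub_apply, mul_sub, mul_add, Finset.sum_sub_distrib,
    Finset.sum_add_distrib, ← Finset.mul_sum]
  generalize ∑ i, pd p i x / 2 * Real.log s * pd g i x = c
  field_simp
  ring

theorem stmt9
    (n : ℕ) (hn : 0 < n)
    (Ω : Set (EuclideanSpace ℝ (Fin n)))
    (hΩo : IsOpen Ω) (hΩconn : IsConnected Ω)
    (hΩbd : Bornology.IsBounded Ω) (hΩsph : ExteriorSphereCond Ω)
    (T : ℝ) (hT : 0 < T)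
    (γ : ℝ) (hγ : γ ∈ Ioo (0:ℝ) 1)
    (p : EuclideanSpace ℝ (Fin n) → ℝ)
    (hp : C1HolderOn γ (closure Ω) p)
    (hp1 : ∀ x ∈ closure Ω, -1 < p x)
    (ε₀ : ℝ) (hε₀ : 0 < ε₀)
    (F : EuclideanSpace ℝ (Fin n) → ℝ → EuclideanSpace ℝ (Fin n) → ℝ)
    (hF : ContinuousOn
      (fun q : EuclideanSpace ℝ (Fin n) × ℝ × EuclideanSpace ℝ (Fin n) => F q.1 q.2.1 q.2.2)
      (closure Ω ×ˢ (univ : Set (ℝ × EuclideanSpace ℝ (Fin n)))))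
    (hFmono : ∀ x ∈ closure Ω, ∀ v w : ℝ, ∀ z : EuclideanSpace ℝ (Fin n),
      w ≤ v → F x v z ≤ F x w z)
    (ψ u₀ : EuclideanSpace ℝ (Fin n) → ℝ)
    (U : Set (EuclideanSpace ℝ (Fin n))) (hU : IsOpen U) (hUΩ : closure Ω ⊆ U)
    (hu₀ : ContDiffOn ℝ 2 u₀ U)
    (hu₀ψ : ∀ x ∈ frontier Ω, u₀ x = ψ x)
    (M : ℝ) (hM : 0 < M)
    (ε : ℝ) (hε : ε ∈ Ioc (0:ℝ) ε₀)
    (u : ℝ → EuclideanSpace ℝ (Fin n) → ℝ)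
    (hu : IsClassicalSolIso Ω T p F ψ u₀ ε u)
    (hub : ∀ t ∈ Icc 0 T, ∀ x ∈ closure Ω, |u t x| ≤ M)
    (A B K₁ : ℝ)
    (hA : IsLUB {a : ℝ | ∃ ε' ∈ Icc (0:ℝ) ε₀, ∃ x ∈ closure Ω,
      a = |∑ i, pd (fun y => (‖gradv u₀ y‖ ^ 2 + ε') ^ (p y / 2) * pd u₀ i y) i x|} A)
    (hB : IsLUB {a : ℝ | ∃ x ∈ closure Ω, ∃ v ∈ Icc (-M) M,
      a = |F x v (gradv u₀ x)|} B)
    (hK₁ : K₁ = A + B)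
    :
    ∀ δ : ℝ, 0 < δ → ∀ t ∈ Icc 0 T, ∀ x ∈ closure Ω,
      u t x - u₀ x ≤ (K₁ + δ) * t := by
  have hsub : Ω ⊆ closure Ω := subset_closure
  obtain ⟨y₀, hy₀⟩ := hΩconn.nonempty
  have hε0 : ε ∈ Icc (0 : ℝ) ε₀ := ⟨hε.1.le, hε.2⟩
  have hA0 : 0 ≤ A := (abs_nonneg _).trans (hA.1 ⟨ε, hε0, y₀, hsub hy₀, rfl⟩)
  have hB0 : 0 ≤ B := (abs_nonneg _).trans (hB.1 ⟨y₀, hsub hy₀, 0, ⟨by linarith, hM.le⟩, rfl⟩)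
  intro δ hδ
  have hK : 0 < K₁ + δ := by linarith
  have hu₀c : ContinuousOn u₀ (closure Ω) := hu₀.continuousOn.mono hUΩ
  have hlt : ∀ t ∈ Ico 0 T, ∀ x ∈ closure Ω, u t x - u₀ x ≤ (K₁ + δ) * t := by
    intro τ hτ y hy
    have hQ : IsCompact (Icc 0 τ ×ˢ closure Ω) := isCompact_Icc.prod hΩbd.isCompact_closure
    have hcont : ContinuousOn
        (fun q : ℝ × EuclideanSpace ℝ (Fin n) => u q.1 q.2 - u₀ q.2 - (K₁ + δ) * q.1)
        (Icc 0 τ ×ˢ closure Ω) := by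
      refine ContinuousOn.sub (ContinuousOn.sub (hu.cont.mono ?_) ?_) (by fun_prop)
      · exact prod_mono (Icc_subset_Icc_right hτ.2.le) le_rfl
      · exact hu₀c.comp continuousOn_snd fun q hq => hq.2
    obtain ⟨⟨t, x⟩, ⟨ht, hx⟩, hmax⟩ := hQ.exists_isMaxOn ⟨(τ, y), ⟨hτ.1, le_rfl⟩, hy⟩ hcont
    simp only at ht hx
    have hmax' : ∀ s ∈ Icc 0 τ, ∀ z ∈ closure Ω,
        u s z - u₀ z - (K₁ + δ) * s ≤ u t x - u₀ x - (K₁ + δ) * t :=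
      fun s hs z hz => hmax (show (s, z) ∈ Icc 0 τ ×ˢ closure Ω from ⟨hs, hz⟩)
    by_contra! hcon
    have hpos := hmax' τ ⟨hτ.1, le_rfl⟩ y hy
    have ht0 : 0 < t := by
      refine ht.1.lt_of_ne fun h => ?_
      rw [← h, hu.init x hx] at hpos
      linarith
    have htT : t ∈ Ioo 0 T := ⟨ht0, ht.2.trans_lt hτ.2⟩
    have hxΩ : x ∈ Ω := by
      by_contra hxn
      have hxf : x ∈ frontier Ω := by rw [hΩo.frontier_eq]; exact ⟨hx, hxn⟩
      rw [hu.bdry t htT x hxf, ← hu₀ψ x hxf] at hpos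
      have := mul_pos hK ht0
      linarith
    have hm : IsLocalMax (fun z => u t z - u₀ z) x := by
      filter_upwards [hΩo.mem_nhds hxΩ] with z hz
      have := hmax' t ht z (hsub hz)
      linarith
    have hpx : DifferentiableAt ℝ p x :=
      (hp.1.differentiableOn (by norm_num)).differentiableAt
        (mem_of_superset (hΩo.mem_nhds hxΩ) hsub)
    obtain ⟨hgrad, hdiv⟩ := div_flux_le (hu.smooth_x t htT x hxΩ)
      (hu₀.contDiffAt (hU.mem_nhds (hUΩ hx))) hpx (hp1 x hx).le hε.1 hm
    have hdt : HasDerivAt (fun s => u s x - (K₁ + δ) * s)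
        (deriv (fun s => u s x) t - (K₁ + δ)) t := by
      simpa using (hu.diff_t t htT x hxΩ).hasDerivAt.fun_sub
        ((hasDerivAt_id t).const_mul (K₁ + δ))
    have hnn := hdt.nonneg_of_le_left ht0 fun s hs => by
      have := hmax' s ⟨hs.1.le, hs.2.le.trans ht.2⟩ x hx
      linarith
    rw [hu.eqn t htT x hxΩ, hgrad] at hnn
    have h1 := (le_abs_self _).trans (hA.1 ⟨ε, hε0, x, hx, rfl⟩)
    have h2 := (le_abs_self _).trans
      (hB.1 ⟨x, hx, u t x, abs_le.1 (hub t ⟨ht0.le, htT.2.le⟩ x hx), rfl⟩)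
    linarith
  intro t ht x hx
  have hcx : ContinuousOn (fun s => u s x - u₀ x) (Icc 0 T) :=
    (hu.cont.comp (by fun_prop : ContinuousOn (fun s : ℝ => (s, x)) (Icc 0 T))
      fun s hs => ⟨hs, hx⟩).sub continuousOn_const
  refine ContinuousWithinAt.closure_le (s := Ico 0 T) (f := fun s => u s x - u₀ x)
    (g := fun s => (K₁ + δ) * s) ?_ ((hcx t ht).mono Ico_subset_Icc_self)
    (by fun_prop) fun s hs => hlt s hs x hx
  rwa [closure_Ico hT.ne]
end
end

section
/- Let u_ε be a classical solution of the regularized anisotropic problem with ε ∈ (0,ε₀], satisfying |u_ε| ≤ M and |∂_t u_ε| ≤ K on Q̄_T, where F = Σ_{i=1}^n f_i(x,u,u_{x_i}) + f₀(x,u) with |f_i(x,u,z_i)| ≤ α|z_i|^{p̃_i+2} + β for positive constants α, β and constants p̃_i with −1 < p̃_i < min_{Ω̄} p_i(x), and f₀ continuous and bounded on Ω̄×[−M,M]. Then there exist constants C_i (i = 1,…,n), independent of ε, such that max_{t∈[0,T]} ∫_Ω |∂_{x_i} u_ε(t,x)|^{p_i(x)+2} dx ≤ C_i for each i = 1,…,n.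 -/
open Set Filter MeasureTheory Metric

noncomputable section

/-- Classical solution of the regularized anisotropic problem
`u_t = ∑ᵢ ((u_{xᵢ}² + ε)^{pᵢ(x)/2} u_{xᵢ})_{xᵢ} + F(x, u, ∇u)` in `Q_T = (0,T) × Ω`,
with `u = ψ` on `∂Ω × (0,T)` and `u(0,·) = u₀` in `Ω`. -/
structure IsClassicalSolAniso {n : ℕ} (Ω : Set (EuclideanSpace ℝ (Fin n))) (T : ℝ)
    (p : Fin n → EuclideanSpace ℝ (Fin n) → ℝ)
    (F : EuclideanSpace ℝ (Fin n) → ℝ → EuclideanSpace ℝ (Fin n) → ℝ)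
    (ψ u₀ : EuclideanSpace ℝ (Fin n) → ℝ) (ε : ℝ)
    (u : ℝ → EuclideanSpace ℝ (Fin n) → ℝ) : Prop where
  cont : ContinuousOn (fun q : ℝ × EuclideanSpace ℝ (Fin n) => u q.1 q.2)
      (Icc 0 T ×ˢ closure Ω)
  diff_t : ∀ t ∈ Ioo 0 T, ∀ x ∈ Ω, DifferentiableAt ℝ (fun s => u s x) t
  smooth_x : ∀ t ∈ Ioo 0 T, ∀ x ∈ Ω, ContDiffAt ℝ 2 (u t) x
  cont_ut : ContinuousOn
      (fun q : ℝ × EuclideanSpace ℝ (Fin n) => deriv (fun s => u s q.2) q.1) (Ioo 0 T ×ˢ Ω)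
  cont_ux : ∀ i, ContinuousOn
      (fun q : ℝ × EuclideanSpace ℝ (Fin n) => pd (u q.1) i q.2) (Ioo 0 T ×ˢ Ω)
  cont_uxx : ∀ i j, ContinuousOn
      (fun q : ℝ × EuclideanSpace ℝ (Fin n) => pd (fun y => pd (u q.1) j y) i q.2)
      (Ioo 0 T ×ˢ Ω)
  eqn : ∀ t ∈ Ioo 0 T, ∀ x ∈ Ω,
      deriv (fun s => u s x) t =
        (∑ i, pd (fun y => ((pd (u t) i y) ^ 2 + ε) ^ (p i y / 2) * pd (u t) i y) i x)
          + F x (u t x) (gradv (u t) x)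
  bdry : ∀ t ∈ Ioo 0 T, ∀ x ∈ frontier Ω, u t x = ψ x
  init : ∀ x ∈ closure Ω, u 0 x = u₀ x

lemma exists_rpow_absorb {B η : ℝ} (Q : ℝ) (hη : 0 < η) (hB : 0 ≤ B) :
    ∃ C, 0 ≤ C ∧ ∀ G, 0 ≤ G → ∀ q r, q ≤ Q → 0 ≤ r → r + η ≤ q →
      B * G ^ r ≤ 1 / 8 * G ^ q + C := by
  set S : ℝ := max 1 ((8 * B) ^ (1 / η)) with hS
  have hS1 : 1 ≤ S := le_max_left _ _
  refine ⟨B * S ^ Q, by positivity, fun G hG q r hq hr hrq => ?_⟩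
  rcases le_or_gt G S with h | h
  · have h1 : G ^ r ≤ S ^ Q :=
      (Real.rpow_le_rpow hG h hr).trans (Real.rpow_le_rpow_of_exponent_le hS1 (by linarith))
    have h2 : 0 ≤ G ^ q := Real.rpow_nonneg hG _
    nlinarith [mul_le_mul_of_nonneg_left h1 hB]
  · have hG1 : 1 < G := hS1.trans_lt h
    have hG0 : 0 < G := by linarith
    have h1 : G ^ (r + η) ≤ G ^ q := Real.rpow_le_rpow_of_exponent_le hG1.le hrq
    have h2 : 8 * B ≤ G ^ η := by
      have h3 : (8 * B) ^ (1 / η) ≤ G := (le_max_right _ _).trans h.le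
      calc 8 * B = ((8 * B) ^ (1 / η)) ^ η := by
            rw [← Real.rpow_mul (by positivity), one_div_mul_cancel hη.ne', Real.rpow_one]
        _ ≤ G ^ η := Real.rpow_le_rpow (by positivity) h3 hη.le
    rw [Real.rpow_add hG0] at h1
    have h4 : 0 ≤ G ^ r := Real.rpow_nonneg hG _
    have h5 : 0 ≤ B * S ^ Q := by positivity
    nlinarith [mul_le_mul_of_nonneg_left h2 h4]

lemma exists_flux_bound {D B ε₀ pmin pt : ℝ} (P : ℝ) (hD : 0 ≤ D) (hB : 0 ≤ B)
    (hpt : -1 < pt) (hptp : pt < pmin) :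
    ∃ C, 0 ≤ C ∧ ∀ ε ∈ Ioc (0 : ℝ) ε₀, ∀ p, pmin ≤ p → p ≤ P → ∀ g d : ℝ, |d| ≤ D →
      1 / 4 * |g| ^ (p + 2) + B * |g| ^ (pt + 2)
        ≤ (g ^ 2 + ε) ^ (p / 2) * g * (g - d) + C := by
  obtain ⟨C₁, hC₁, h₁⟩ := exists_rpow_absorb (P + 2) (sub_pos.2 hptp) hB
  obtain ⟨C₂, hC₂, h₂⟩ := exists_rpow_absorb (P + 2) one_pos hD
  set S : ℝ := max 1 (Real.sqrt (2 * ε₀))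
  have hS1 : 1 ≤ S := le_max_left _ _
  refine ⟨C₁ + C₂ + S ^ (P + 2), by positivity, fun ε hε p hp hpP g d hd => ?_⟩
  have hs : 0 < g ^ 2 + ε := by have := hε.1; positivity
  set G := Real.sqrt (g ^ 2 + ε) with hGdef
  have hG : 0 < G := Real.sqrt_pos.2 hs
  have hG2 : G ^ 2 = g ^ 2 + ε := Real.sq_sqrt hs.le
  have hgG : |g| ≤ G := Real.abs_le_sqrt (by linarith [hε.1])
  have hpow : (g ^ 2 + ε) ^ (p / 2) = G ^ p := by
    rw [← hG2, ← Real.rpow_natCast, ← Real.rpow_mul hG.le]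
    congr 1
    push_cast
    ring
  rw [hpow]
  have hGp : 0 < G ^ p := Real.rpow_pos_of_pos hG _
  have e1 : G ^ (p + 1) = G ^ p * G := by rw [Real.rpow_add hG, Real.rpow_one]
  have e2 : G ^ (p + 2) = G ^ p * G ^ 2 := by
    rw [Real.rpow_add hG]
    norm_num
  have k1 := h₁ G hG.le (p + 2) (pt + 2) (by linarith) (by linarith) (by linarith)
  have k2 := h₂ G hG.le (p + 2) (p + 1) (by linarith) (by linarith) (by linarith)
  have k3 : |g| ^ (p + 2) ≤ G ^ (p + 2) := Real.rpow_le_rpow (abs_nonneg _) hgG (by linarith)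
  have k4 : |g| ^ (pt + 2) ≤ G ^ (pt + 2) :=
    Real.rpow_le_rpow (abs_nonneg _) hgG (by linarith)
  have k5 : G ^ p * (g * d) ≤ D * G ^ (p + 1) := by
    rw [e1]
    have : g * d ≤ G * D := (le_abs_self _).trans (by rw [abs_mul]; gcongr)
    nlinarith [mul_le_mul_of_nonneg_left this hGp.le]
  have k6 : 1 / 2 * G ^ (p + 2) ≤ G ^ p * g ^ 2 + S ^ (P + 2) := by
    have hSP : 0 ≤ S ^ (P + 2) := by positivity
    rcases le_or_gt ε (g ^ 2) with h | h
    · rw [e2, hG2]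
      nlinarith [mul_le_mul_of_nonneg_left h hGp.le]
    · have hGS : G ≤ S := (Real.sqrt_le_sqrt (by linarith [hε.2])).trans (le_max_right _ _)
      have : G ^ (p + 2) ≤ S ^ (P + 2) :=
        (Real.rpow_le_rpow hG.le hGS (by linarith)).trans
          (Real.rpow_le_rpow_of_exponent_le hS1 (by linarith))
      have h0 : 0 ≤ G ^ p * g ^ 2 := by positivity
      have h0' : 0 ≤ G ^ (p + 2) := by positivity
      linarith
  have k7 := mul_le_mul_of_nonneg_left k4 hB
  have e3 : G ^ p * g * (g - d) = G ^ p * g ^ 2 - G ^ p * (g * d) := by ring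
  rw [e3]
  linarith

/-- A ramp which vanishes on `[-δ, δ]` and equals `1` outside `[-2δ, 2δ]`. -/
def ramp (δ s : ℝ) : ℝ := max 0 (min 1 (|s| / δ - 1))

/-- The primitive of `ramp δ` vanishing at the origin. -/
def rampInt (δ s : ℝ) : ℝ := ∫ r in (0 : ℝ)..s, ramp δ r

lemma continuous_ramp (δ : ℝ) : Continuous (ramp δ) := by
  unfold ramp
  fun_prop

lemma ramp_nonneg (δ s : ℝ) : 0 ≤ ramp δ s := le_max_left _ _

lemma ramp_le_one (δ s : ℝ) : ramp δ s ≤ 1 := max_le zero_le_one (min_le_left _ _)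

lemma ramp_mono {δ : ℝ} (hδ : 0 < δ) {r s : ℝ} (h : |r| ≤ |s|) : ramp δ r ≤ ramp δ s := by
  unfold ramp
  gcongr

lemma ramp_eq_zero {δ : ℝ} (hδ : 0 < δ) {s : ℝ} (h : |s| ≤ δ) : ramp δ s = 0 := by
  have : |s| / δ ≤ 1 := (div_le_one hδ).2 h
  exact max_eq_left ((min_le_right _ _).trans (by linarith))

lemma ramp_eq_one {δ : ℝ} (hδ : 0 < δ) {s : ℝ} (h : 2 * δ ≤ |s|) : ramp δ s = 1 := by
  have : 2 ≤ |s| / δ := (le_div_iff₀ hδ).2 h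
  unfold ramp
  rw [min_eq_left (by linarith), max_eq_right zero_le_one]

lemma hasDerivAt_rampInt (δ s : ℝ) : HasDerivAt (rampInt δ) (ramp δ s) s :=
  intervalIntegral.integral_hasDerivAt_right ((continuous_ramp δ).intervalIntegrable _ _)
    (continuous_ramp δ).stronglyMeasurable.stronglyMeasurableAtFilter
    (continuous_ramp δ).continuousAt

lemma contDiff_rampInt (δ : ℝ) : ContDiff ℝ 1 (rampInt δ) := by
  rw [contDiff_one_iff_deriv]
  refine ⟨fun s => (hasDerivAt_rampInt δ s).differentiableAt, ?_⟩
  have : deriv (rampInt δ) = ramp δ := funext fun s => (hasDerivAt_rampInt δ s).deriv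
  rw [this]
  exact continuous_ramp δ

lemma abs_rampInt_le {δ : ℝ} (hδ : 0 < δ) (s : ℝ) : |rampInt δ s| ≤ ramp δ s * |s| := by
  have := intervalIntegral.norm_integral_le_of_norm_le_const (a := 0) (b := s) (f := ramp δ)
    (C := ramp δ s) fun r hr => by
      rw [Real.norm_eq_abs, abs_of_nonneg (ramp_nonneg _ _)]
      refine ramp_mono hδ ?_
      rcases le_total 0 s with h | h
      · rw [uIoc_of_le h] at hr
        rw [abs_of_pos hr.1, abs_of_nonneg h]
        exact hr.2
      · rw [uIoc_of_ge h] at hr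
        rw [abs_of_nonpos hr.2, abs_of_nonpos h]
        linarith [hr.1]
  simpa [rampInt] using this

lemma rampInt_eq_zero {δ : ℝ} (hδ : 0 < δ) {s : ℝ} (h : |s| ≤ δ) : rampInt δ s = 0 := by
  have := abs_rampInt_le hδ s
  rw [ramp_eq_zero hδ h, zero_mul] at this
  exact abs_nonpos_iff.1 this

lemma integral_pd_eq_zero {n : ℕ} {B : EuclideanSpace ℝ (Fin n) → ℝ} (hB : ContDiff ℝ 1 B)
    (hc : HasCompactSupport B) (i : Fin n) : Integrable (pd B i) ∧ ∫ x, pd B i x = 0 := by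
  have hd : Continuous (pd B i) := (hB.continuous_fderiv one_ne_zero).clm_apply continuous_const
  have hcs : HasCompactSupport (pd B i) := hc.fderiv_apply ℝ _
  have hi : Integrable (pd B i) := hd.integrable_of_hasCompactSupport hcs
  refine ⟨hi, ?_⟩
  have := integral_mul_fderiv_eq_neg_fderiv_mul_of_integrable (μ := volume)
    (f := fun _ : EuclideanSpace ℝ (Fin n) => (1 : ℝ)) (g := B) (v := EuclideanSpace.single i 1)
    (by simp) (by simp only [one_mul]; exact hi)
    (by simpa using hB.continuous.integrable_of_hasCompactSupport hc)
    (fun _ _ => differentiableAt_const _) (fun x _ => hB.differentiable one_ne_zero x)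
  simpa [pd] using this

lemma integral_pd_mul_rampInt {n : ℕ} {Ω : Set (EuclideanSpace ℝ (Fin n))} (hΩo : IsOpen Ω)
    (hΩbd : Bornology.IsBounded Ω) {a v : EuclideanSpace ℝ (Fin n) → ℝ}
    (ha : ∀ x ∈ Ω, ContDiffAt ℝ 1 a x) (hv : ∀ x ∈ Ω, ContDiffAt ℝ 1 v x)
    (hvc : ContinuousOn v (closure Ω)) (hv0 : ∀ x ∈ frontier Ω, v x = 0) {δ : ℝ} (hδ : 0 < δ)
    (i : Fin n) :
    IntegrableOn (fun x => pd a i x * rampInt δ (v x) + ramp δ (v x) * (a x * pd v i x)) Ω ∧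
      ∫ x in Ω, (pd a i x * rampInt δ (v x) + ramp δ (v x) * (a x * pd v i x)) = 0 := by
  set B : EuclideanSpace ℝ (Fin n) → ℝ := Ω.indicator fun x => a x * rampInt δ (v x) with hBdef
  have hout : ∀ x, x ∉ Ω → B =ᶠ[nhds x] 0 := by
    intro x hx
    by_cases hxc : x ∈ closure Ω
    · have hxf : x ∈ frontier Ω := by
        rw [hΩo.frontier_eq]
        exact ⟨hxc, hx⟩
      have h1 : ∀ᶠ y in nhdsWithin x (closure Ω), |v y| < δ := by
        have h2 := (hvc x hxc).abs
        refine h2.eventually_lt_const ?_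
        simpa [hv0 x hxf] using hδ
      rw [eventually_nhdsWithin_iff] at h1
      filter_upwards [h1] with y hy
      by_cases hyΩ : y ∈ Ω
      · simp [hBdef, hyΩ, rampInt_eq_zero hδ (hy (subset_closure hyΩ)).le]
      · simp [hBdef, hyΩ]
    · filter_upwards [isClosed_closure.isOpen_compl.mem_nhds hxc] with y hy
      have : y ∉ Ω := fun h => hy (subset_closure h)
      simp [hBdef, this]
  have hin : ∀ x ∈ Ω, B =ᶠ[nhds x] fun x => a x * rampInt δ (v x) := by
    intro x hx
    filter_upwards [hΩo.mem_nhds hx] with y hy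
    simp [hBdef, hy]
  have hB : ContDiff ℝ 1 B := by
    rw [contDiff_iff_contDiffAt]
    intro x
    by_cases hx : x ∈ Ω
    · refine ContDiffAt.congr_of_eventuallyEq ?_ (hin x hx)
      exact (ha x hx).mul ((contDiff_rampInt δ).contDiffAt.comp x (hv x hx))
    · exact contDiffAt_const.congr_of_eventuallyEq (hout x hx)
  have hc : HasCompactSupport B := by
    refine HasCompactSupport.intro hΩbd.isCompact_closure fun x hx => ?_
    have : x ∉ Ω := fun h => hx (subset_closure h)
    simp [hBdef, this]
  obtain ⟨h1, h2⟩ := integral_pd_eq_zero hB hc i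
  have hpd : pd B i =
      Ω.indicator fun x => pd a i x * rampInt δ (v x) + ramp δ (v x) * (a x * pd v i x) := by
    funext x
    by_cases hx : x ∈ Ω
    · have hva := ((hv x hx).differentiableAt one_ne_zero).hasFDerivAt
      have haa := ((ha x hx).differentiableAt one_ne_zero).hasFDerivAt
      have := haa.mul ((hasDerivAt_rampInt δ (v x)).comp_hasFDerivAt x hva)
      rw [Set.indicator_of_mem hx, pd, (hin x hx).fderiv_eq]
      erw [this.fderiv]
      simp [pd]
      ring
    · rw [Set.indicator_of_notMem hx, pd, (hout x hx).fderiv_eq]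
      simp
  rw [hpd] at h1 h2
  rw [integral_indicator hΩo.measurableSet] at h2
  exact ⟨(integrable_indicator_iff hΩo.measurableSet).1 h1, h2⟩

lemma lintegral_le_of_flux {n : ℕ} {Ω : Set (EuclideanSpace ℝ (Fin n))} (hΩo : IsOpen Ω)
    (hΩbd : Bornology.IsBounded Ω) {a : Fin n → EuclideanSpace ℝ (Fin n) → ℝ}
    {v h : EuclideanSpace ℝ (Fin n) → ℝ}
    (ha : ∀ i, ∀ x ∈ Ω, ContDiffAt ℝ 1 (a i) x) (hv : ∀ x ∈ Ω, ContDiffAt ℝ 1 v x)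
    (hvc : ContinuousOn v (closure Ω)) (hv0 : ∀ x ∈ frontier Ω, v x = 0)
    (hh : ContinuousOn h Ω) (hh0 : ∀ x ∈ Ω, 0 ≤ h x) {C : ℝ} (hC : 0 ≤ C)
    (hle : ∀ x ∈ Ω, h x + |v x| * |∑ i, pd (a i) i x| ≤ ∑ i, a i x * pd v i x + C) :
    ∫⁻ x in Ω, (if v x = 0 then 0 else ENNReal.ofReal (h x)) ≤
      ENNReal.ofReal C * volume Ω := by
  have hfin : volume Ω < ⊤ := hΩbd.measure_lt_top
  have hcv : ContinuousOn v Ω := hvc.mono subset_closure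
  have hkey : ∀ δ, 0 < δ → ∫⁻ x in Ω, ENNReal.ofReal (ramp δ (v x) * h x) ≤
      ENNReal.ofReal C * volume Ω := by
    intro δ hδ
    have H := fun i => integral_pd_mul_rampInt hΩo hΩbd (ha i) hv hvc hv0 hδ i
    set J : EuclideanSpace ℝ (Fin n) → ℝ := fun x => ∑ i,
      (pd (a i) i x * rampInt δ (v x) + ramp δ (v x) * (a i x * pd v i x)) with hJ
    have hJi : IntegrableOn J Ω := integrable_finsetSum _ fun i _ => (H i).1
    have hJ0 : ∫ x in Ω, J x = 0 := by
      rw [hJ, integral_finsetSum _ fun i _ => (H i).1]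
      exact Finset.sum_eq_zero fun i _ => (H i).2
    have hpt : ∀ x ∈ Ω, ramp δ (v x) * h x ≤ J x + C := by
      intro x hx
      have e : J x = (∑ i, pd (a i) i x) * rampInt δ (v x) +
          ramp δ (v x) * ∑ i, a i x * pd v i x := by
        rw [hJ, Finset.sum_mul, Finset.mul_sum, ← Finset.sum_add_distrib]
      have k1 := mul_le_mul_of_nonneg_left (hle x hx) (ramp_nonneg δ (v x))
      have k2 : -((∑ i, pd (a i) i x) * rampInt δ (v x)) ≤
          ramp δ (v x) * (|v x| * |∑ i, pd (a i) i x|) := by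
        refine (neg_le_abs _).trans ?_
        rw [abs_mul]
        nlinarith [mul_le_mul_of_nonneg_left (abs_rampInt_le hδ (v x))
          (abs_nonneg (∑ i, pd (a i) i x))]
      have k3 := mul_le_mul_of_nonneg_right (ramp_le_one δ (v x)) hC
      rw [e]
      linarith
    have hCi : IntegrableOn (fun _ : EuclideanSpace ℝ (Fin n) => C) Ω :=
      integrableOn_const hfin.ne
    have hJC : IntegrableOn (fun x => J x + C) Ω := hJi.add hCi
    calc ∫⁻ x in Ω, ENNReal.ofReal (ramp δ (v x) * h x)
        ≤ ∫⁻ x in Ω, ENNReal.ofReal (J x + C) :=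
          setLIntegral_mono' hΩo.measurableSet fun x hx => ENNReal.ofReal_le_ofReal (hpt x hx)
      _ = ENNReal.ofReal (∫ x in Ω, (J x + C)) := by
          refine (ofReal_integral_eq_lintegral_ofReal hJC ?_).symm
          refine (ae_restrict_iff' hΩo.measurableSet).2 (Eventually.of_forall fun x hx => ?_)
          exact (mul_nonneg (ramp_nonneg _ _) (hh0 x hx)).trans (hpt x hx)
      _ = ENNReal.ofReal C * volume Ω := by
          rw [integral_add hJi hCi, hJ0, setIntegral_const, zero_add, smul_eq_mul, mul_comm,
            ENNReal.ofReal_mul hC, Measure.real, ENNReal.ofReal_toReal hfin.ne]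
  have hlim : ∀ x, (if v x = 0 then 0 else ENNReal.ofReal (h x)) ≤
      liminf (fun k : ℕ => ENNReal.ofReal (ramp (1 / ((k : ℝ) + 1)) (v x) * h x)) atTop := by
    intro x
    split_ifs with h0
    · exact zero_le
    · have h1 : ∀ᶠ k : ℕ in atTop, 1 / ((k : ℝ) + 1) < |v x| / 2 :=
        tendsto_one_div_add_atTop_nhds_zero_nat.eventually_lt_const
          (half_pos (abs_pos.2 h0))
      refine le_liminf_of_le (by isBoundedDefault) ?_
      filter_upwards [h1] with k hk
      rw [ramp_eq_one (by positivity) (by linarith), one_mul]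
  calc _ ≤ ∫⁻ x in Ω,
        liminf (fun k : ℕ => ENNReal.ofReal (ramp (1 / ((k : ℝ) + 1)) (v x) * h x)) atTop :=
        lintegral_mono hlim
    _ ≤ liminf (fun k : ℕ =>
        ∫⁻ x in Ω, ENNReal.ofReal (ramp (1 / ((k : ℝ) + 1)) (v x) * h x)) atTop := by
        refine lintegral_liminf_le' fun k => ?_
        exact ((((continuous_ramp _).comp_continuousOn hcv).mul hh).aemeasurable
          hΩo.measurableSet).ennreal_ofReal
    _ ≤ _ := by
        refine liminf_le_of_le (by isBoundedDefault) fun b hb => ?_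
        obtain ⟨k, hk⟩ := hb.exists
        exact hk.trans (hkey _ (by positivity))

/-- The gradient of a function vanishes almost everywhere on its zero set. -/
lemma ae_pd_eq_zero_of_eq_zero {n : ℕ} {Ω : Set (EuclideanSpace ℝ (Fin n))} (hΩo : IsOpen Ω)
    {v : EuclideanSpace ℝ (Fin n) → ℝ} (hv : ∀ x ∈ Ω, DifferentiableAt ℝ v x) (i : Fin n) :
    ∀ᵐ x ∂volume.restrict Ω, v x = 0 → pd v i x = 0 := by
  set e : EuclideanSpace ℝ (Fin n) := EuclideanSpace.single i 1 with he
  set s : Set (EuclideanSpace ℝ (Fin n)) := Ω ∩ {x | v x = 0} with hs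
  have hcv : ContinuousOn v Ω := fun x hx => (hv x hx).continuousAt.continuousWithinAt
  have hsm : MeasurableSet s := by
    have : s = Ω \ (Ω ∩ v ⁻¹' {0}ᶜ) := by
      ext x
      simp [hs]
    rw [this]
    exact hΩo.measurableSet.diff
      (hcv.isOpen_inter_preimage hΩo isOpen_compl_singleton).measurableSet
  have h1 : ApproximatesLinearOn (fun x => v x • e)
      (0 : EuclideanSpace ℝ (Fin n) →L[ℝ] EuclideanSpace ℝ (Fin n)) s 0 := by
    intro x hx y hy
    have hx0 : v x = 0 := hx.2
    have hy0 : v y = 0 := hy.2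
    simp [hx0, hy0]
  have h2 := h1.norm_fderiv_sub_le volume hsm (fun x => (fderiv ℝ v x).smulRight e)
    fun x hx => ((hv x hx.1).hasFDerivAt.smul_const e).hasFDerivWithinAt
  rw [ae_restrict_iff' hsm] at h2
  rw [ae_restrict_iff' hΩo.measurableSet]
  filter_upwards [h2] with x hx hxΩ hx0
  have h3 := hx ⟨hxΩ, hx0⟩
  have he0 : e ≠ 0 := by simp [he]
  have h4 : fderiv ℝ v x = 0 := by simpa [he0] using h3
  simp [pd, h4]

lemma continuousOn_pd {n : ℕ} {Ω : Set (EuclideanSpace ℝ (Fin n))} (hΩo : IsOpen Ω)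
    {w : EuclideanSpace ℝ (Fin n) → ℝ} (hw : ∀ x ∈ Ω, ContDiffAt ℝ 1 w x) (i : Fin n) :
    ContinuousOn (pd w i) Ω := by
  have : ContDiffOn ℝ 1 w Ω := fun x hx => (hw x hx).contDiffWithinAt
  exact (this.continuousOn_fderiv_of_isOpen hΩo le_rfl).clm_apply continuousOn_const

lemma continuousOn_abs_rpow {X : Type*} [TopologicalSpace X] {s : Set X} {g q : X → ℝ}
    (hg : ContinuousOn g s) (hq : ContinuousOn q s) (h0 : ∀ x ∈ s, 0 < q x) :
    ContinuousOn (fun x => |g x| ^ q x) s :=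
  hg.abs.rpow hq fun x hx => Or.inr (h0 x hx)

/-- A difference quotient is controlled by the average of the partial derivative, at the level of
powers with a Lipschitz variable exponent. -/
lemma ofReal_diffQuot_rpow_le {n : ℕ} {Ω : Set (EuclideanSpace ℝ (Fin n))} (hΩo : IsOpen Ω)
    {w q : EuclideanSpace ℝ (Fin n) → ℝ} (hw : ∀ x ∈ Ω, ContDiffAt ℝ 1 w x) {M L h : ℝ}
    (hM : ∀ x ∈ Ω, |w x| ≤ M) (hL : 0 ≤ L) (hh : 0 < h) (i : Fin n)
    {x : EuclideanSpace ℝ (Fin n)}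
    (hseg : ∀ s ∈ Icc (0 : ℝ) 1, x + (s * h) • EuclideanSpace.single i (1 : ℝ) ∈ Ω)
    (hqL : ∀ s ∈ Icc (0 : ℝ) 1,
      q x - L * h ≤ q (x + (s * h) • EuclideanSpace.single i (1 : ℝ)))
    (hq1 : 1 ≤ q x - L * h) :
    ENNReal.ofReal (|h⁻¹ * (w (x + h • EuclideanSpace.single i (1 : ℝ)) - w x)| ^ q x) ≤
      ENNReal.ofReal (Real.exp (2 * M * L)) * ∫⁻ s in Icc (0 : ℝ) 1,
        ENNReal.ofReal (1 + |pd w i (x + (s * h) • EuclideanSpace.single i (1 : ℝ))| ^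
          q (x + (s * h) • EuclideanSpace.single i (1 : ℝ))) := by
  set e : EuclideanSpace ℝ (Fin n) := EuclideanSpace.single i 1 with he
  set g : ℝ → ℝ := fun s => pd w i (x + (s * h) • e) with hg
  set m := q x - L * h with hm
  set D := h⁻¹ * (w (x + h • e) - w x) with hD
  have hline : Continuous fun s : ℝ => x + (s * h) • e := by fun_prop
  have hgc : ContinuousOn g (Icc 0 1) :=
    (continuousOn_pd hΩo hw i).comp hline.continuousOn hseg
  have hgi : IntegrableOn (fun s => |g s|) (Icc 0 1) := hgc.abs.integrableOn_Icc
  have hgm : ContinuousOn (fun s => |g s| ^ m) (Icc 0 1) :=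
    hgc.abs.rpow_const fun _ _ => Or.inr (by linarith)
  have hgmi : IntegrableOn (fun s => |g s| ^ m) (Icc 0 1) := hgm.integrableOn_Icc
  have hvol : (volume : Measure ℝ).real (Icc 0 1) = 1 := by simp
  have hFTC : ∫ s in (0 : ℝ)..1, g s = D := by
    have hder : ∀ s ∈ uIcc (0 : ℝ) 1,
        HasDerivAt (fun s => h⁻¹ * w (x + (s * h) • e)) (g s) s := by
      intro s hs
      rw [uIcc_of_le zero_le_one] at hs
      have h1 : HasDerivAt (fun s : ℝ => x + (s * h) • e) (h • e) s := by
        simpa using (((hasDerivAt_id s).mul_const h).smul_const e).const_add x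
      have h2 := ((hw _ (hseg s hs)).differentiableAt one_ne_zero).hasFDerivAt.comp_hasDerivAt s h1
      refine (h2.const_mul h⁻¹).congr_deriv ?_
      simp [hg, pd, he, hh.ne']
    have hgint : IntervalIntegrable g volume 0 1 := by
      refine ContinuousOn.intervalIntegrable ?_
      rwa [uIcc_of_le zero_le_one]
    rw [intervalIntegral.integral_eq_sub_of_hasDerivAt hder hgint]
    simp [hD, mul_sub]
  have hDle : |D| ≤ ∫ s in Icc (0 : ℝ) 1, |g s| := by
    rw [← hFTC, integral_Icc_eq_integral_Ioc, ← intervalIntegral.integral_of_le zero_le_one]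
    exact intervalIntegral.abs_integral_le_integral_abs zero_le_one
  have hJ : (∫ s in Icc (0 : ℝ) 1, |g s|) ^ m ≤ ∫ s in Icc (0 : ℝ) 1, |g s| ^ m := by
    have := (convexOn_rpow hq1).map_set_average_le (μ := volume) (t := Icc (0 : ℝ) 1)
      (f := fun s => |g s|) (Real.continuous_rpow_const (by linarith)).continuousOn isClosed_Ici
      (by simp) (by simp) (Eventually.of_forall fun s => mem_Ici.2 (abs_nonneg _)) hgi hgmi
    simpa only [setAverage_eq, hvol, inv_one, one_smul] using this
  have hDM : |D| ≤ 2 * M / h := by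
    have hx0 : x ∈ Ω := by simpa using hseg 0 (by simp)
    have hx1 : x + h • e ∈ Ω := by simpa using hseg 1 (by simp)
    rw [hD, abs_mul, abs_of_pos (inv_pos.2 hh), inv_mul_eq_div]
    gcongr
    have a1 := abs_le.1 (hM _ hx0)
    have a2 := abs_le.1 (hM _ hx1)
    exact abs_le.2 ⟨by linarith, by linarith⟩
  have hDL : |D| ^ (L * h) ≤ Real.exp (2 * M * L) := by
    calc |D| ^ (L * h) ≤ Real.exp (2 * M / h) ^ (L * h) := by
          refine Real.rpow_le_rpow (abs_nonneg _) (hDM.trans ?_) (by positivity)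
          linarith [Real.add_one_le_exp (2 * M / h)]
      _ = Real.exp (2 * M * L) := by
          rw [← Real.exp_mul]
          congr 1
          field_simp
  have hDq : |D| ^ q x ≤ Real.exp (2 * M * L) * ∫ s in Icc (0 : ℝ) 1, |g s| ^ m := by
    have h1 : |D| ^ q x = |D| ^ (L * h) * |D| ^ m := by
      rw [← Real.rpow_add_of_nonneg (abs_nonneg _) (by positivity) (by linarith)]
      congr 1
      rw [hm]
      ring
    rw [h1]
    exact mul_le_mul hDL ((Real.rpow_le_rpow (abs_nonneg _) hDle (by linarith)).trans hJ)
      (by positivity) (Real.exp_nonneg _)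
  refine (ENNReal.ofReal_le_ofReal hDq).trans ?_
  rw [ENNReal.ofReal_mul (Real.exp_nonneg _), ofReal_integral_eq_lintegral_ofReal hgmi
    (Eventually.of_forall fun s => by positivity)]
  gcongr ENNReal.ofReal _ * ?_
  refine setLIntegral_mono' measurableSet_Icc fun s hs => ENNReal.ofReal_le_ofReal ?_
  rcases le_total |g s| 1 with h1 | h1
  · have h2 := Real.rpow_le_one (abs_nonneg (g s)) h1 (show 0 ≤ m by linarith)
    have h3 : 0 ≤ |g s| ^ q (x + (s * h) • e) := by positivity
    linarith
  · have h2 := Real.rpow_le_rpow_of_exponent_le h1 (hqL s hs)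
    linarith

/-- The points of `Ω` at distance greater than `h` from the complement. -/
def innerSet {n : ℕ} (Ω : Set (EuclideanSpace ℝ (Fin n))) (h : ℝ) :
    Set (EuclideanSpace ℝ (Fin n)) :=
  {x | ENNReal.ofReal h < infEDist x Ωᶜ}

lemma isOpen_innerSet {n : ℕ} (Ω : Set (EuclideanSpace ℝ (Fin n))) (h : ℝ) :
    IsOpen (innerSet Ω h) :=
  isOpen_lt continuous_const continuous_infEDist

lemma add_smul_mem_of_mem_innerSet {n : ℕ} {Ω : Set (EuclideanSpace ℝ (Fin n))} {h : ℝ}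
    {x : EuclideanSpace ℝ (Fin n)} (hx : x ∈ innerSet Ω h) {r : ℝ} (hr : r ∈ Icc 0 h)
    (i : Fin n) : x + r • EuclideanSpace.single i (1 : ℝ) ∈ Ω := by
  by_contra hc
  have h1 : infEDist x Ωᶜ ≤ _ := infEDist_le_edist_of_mem hc
  have h2 : edist x (x + r • EuclideanSpace.single i (1 : ℝ)) = ENNReal.ofReal r := by
    rw [edist_dist, dist_self_add_right, norm_smul]
    simp [abs_of_nonneg hr.1]
  rw [h2] at h1
  exact absurd (h1.trans (ENNReal.ofReal_le_ofReal hr.2)) (not_le.2 hx)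

lemma innerSet_subset {n : ℕ} {Ω : Set (EuclideanSpace ℝ (Fin n))} {h : ℝ} :
    innerSet Ω h ⊆ Ω := by
  intro x hx
  by_contra hc
  have h1 : infEDist x Ωᶜ = 0 := infEDist_zero_of_mem hc
  simp [innerSet, h1] at hx

lemma lintegral_diffQuot_rpow_le {n : ℕ} {Ω : Set (EuclideanSpace ℝ (Fin n))} (hΩo : IsOpen Ω)
    {w q : EuclideanSpace ℝ (Fin n) → ℝ} (hw : ∀ x ∈ Ω, ContDiffAt ℝ 1 w x) {M L h : ℝ}
    (hM : ∀ x ∈ Ω, |w x| ≤ M) (hL : 0 ≤ L) (hh : 0 < h) (i : Fin n)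
    (hqc : ContinuousOn q Ω)
    (hqL : ∀ x y, segment ℝ x y ⊆ Ω → q x - L * dist x y ≤ q y)
    (hq1 : ∀ x ∈ Ω, 1 + L * h ≤ q x) :
    ∫⁻ x in innerSet Ω h,
        ENNReal.ofReal (|h⁻¹ * (w (x + h • EuclideanSpace.single i (1 : ℝ)) - w x)| ^ q x) ≤
      ENNReal.ofReal (Real.exp (2 * M * L)) *
        ∫⁻ x in Ω, ENNReal.ofReal (1 + |pd w i x| ^ q x) := by
  classical
  set e : EuclideanSpace ℝ (Fin n) := EuclideanSpace.single i 1 with he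
  set G : EuclideanSpace ℝ (Fin n) → ENNReal :=
    Ω.indicator fun x => ENNReal.ofReal (1 + |pd w i x| ^ q x) with hG
  have hq0 : ∀ x ∈ Ω, 0 < q x := fun x hx =>
    lt_of_lt_of_le (by positivity) (hq1 x hx)
  have hGm : Measurable G := by
    rw [hG, ← Set.piecewise_eq_indicator]
    refine ContinuousOn.measurable_piecewise ?_ continuousOn_const hΩo.measurableSet
    exact ENNReal.continuous_ofReal.comp_continuousOn
      (continuousOn_const.add (continuousOn_abs_rpow (continuousOn_pd hΩo hw i) hqc hq0))
  have hpt : ∀ x ∈ innerSet Ω h,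
      ENNReal.ofReal (|h⁻¹ * (w (x + h • e) - w x)| ^ q x) ≤
        ENNReal.ofReal (Real.exp (2 * M * L)) * ∫⁻ s in Icc (0 : ℝ) 1, G (x + (s * h) • e) := by
    intro x hx
    have hseg : ∀ s ∈ Icc (0 : ℝ) 1, x + (s * h) • e ∈ Ω := fun s hs =>
      add_smul_mem_of_mem_innerSet hx ⟨mul_nonneg hs.1 hh.le, by nlinarith [hs.2]⟩ i
    have hsegq : ∀ s ∈ Icc (0 : ℝ) 1, q x - L * h ≤ q (x + (s * h) • e) := by
      intro s hs
      have hsub : segment ℝ x (x + (s * h) • e) ⊆ Ω := by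
        rw [segment_eq_image']
        rintro _ ⟨r, hr, rfl⟩
        have := hseg (r * s) ⟨mul_nonneg hr.1 hs.1, mul_le_one₀ hr.2 hs.1 hs.2⟩
        simpa [smul_smul, mul_assoc] using this
      have hdist : dist x (x + (s * h) • e) ≤ h := by
        have hnorm : ‖(s * h) • e‖ = s * h := by
          rw [norm_smul]
          simp [he, abs_of_nonneg hs.1, abs_of_pos hh]
        rw [dist_self_add_right, hnorm]
        nlinarith [hs.2]
      have := hqL _ _ hsub
      nlinarith [mul_le_mul_of_nonneg_left hdist hL]
    refine (ofReal_diffQuot_rpow_le hΩo hw hM hL hh i hseg hsegq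
      (by linarith [hq1 x (innerSet_subset hx)])).trans_eq ?_
    congr 1
    refine setLIntegral_congr_fun measurableSet_Icc fun s hs => ?_
    rw [hG, Set.indicator_of_mem (hseg s hs)]
  calc _ ≤ ∫⁻ x in innerSet Ω h,
        ENNReal.ofReal (Real.exp (2 * M * L)) * ∫⁻ s in Icc (0 : ℝ) 1, G (x + (s * h) • e) :=
        setLIntegral_mono' (isOpen_innerSet Ω h).measurableSet hpt
    _ ≤ ∫⁻ x,
        ENNReal.ofReal (Real.exp (2 * M * L)) * ∫⁻ s in Icc (0 : ℝ) 1, G (x + (s * h) • e) :=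
        setLIntegral_le_lintegral _ _
    _ = ENNReal.ofReal (Real.exp (2 * M * L)) *
        ∫⁻ x, ∫⁻ s in Icc (0 : ℝ) 1, G (x + (s * h) • e) :=
        lintegral_const_mul' _ _ ENNReal.ofReal_ne_top
    _ = ENNReal.ofReal (Real.exp (2 * M * L)) *
        ∫⁻ s in Icc (0 : ℝ) 1, ∫⁻ x, G (x + (s * h) • e) := by
        rw [lintegral_lintegral_swap]
        refine (hGm.comp ?_).aemeasurable
        fun_prop
    _ = ENNReal.ofReal (Real.exp (2 * M * L)) * ∫⁻ x, G x := by
        simp [lintegral_add_right_eq_self]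
    _ = _ := by rw [hG, lintegral_indicator hΩo.measurableSet]

lemma tendsto_diffQuot {n : ℕ} {w : EuclideanSpace ℝ (Fin n) → ℝ} {x : EuclideanSpace ℝ (Fin n)}
    (hw : DifferentiableAt ℝ w x) (i : Fin n) {h : ℕ → ℝ} (hpos : ∀ j, 0 < h j)
    (hlim : Tendsto h atTop (nhds 0)) :
    Tendsto (fun j => (h j)⁻¹ * (w (x + h j • EuclideanSpace.single i (1 : ℝ)) - w x)) atTop
      (nhds (pd w i x)) := by
  have h1 : HasDerivAt (fun r : ℝ => w (x + r • EuclideanSpace.single i (1 : ℝ)))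
      (pd w i x) 0 := by
    have h2 : HasDerivAt (fun r : ℝ => x + r • EuclideanSpace.single i (1 : ℝ))
        (EuclideanSpace.single i (1 : ℝ)) 0 := by
      simpa using ((hasDerivAt_id (0 : ℝ)).smul_const
        (EuclideanSpace.single i (1 : ℝ))).const_add x
    have h3 : HasFDerivAt w (fderiv ℝ w x) (x + (0 : ℝ) • EuclideanSpace.single i (1 : ℝ)) := by
      simpa using hw.hasFDerivAt
    exact h3.comp_hasDerivAt 0 h2
  have h4 : Tendsto h atTop (nhdsWithin 0 {0}ᶜ) :=
    tendsto_nhdsWithin_iff.2 ⟨hlim, Eventually.of_forall fun j => (hpos j).ne'⟩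
  simpa [Function.comp_def] using h1.tendsto_slope_zero.comp h4

/-- Uniform bounds on variable exponent energies of `C¹` functions pass to the pointwise partial
derivatives of their pointwise limit. -/
lemma lintegral_pd_rpow_le_of_tendsto {n : ℕ} {Ω : Set (EuclideanSpace ℝ (Fin n))}
    (hΩo : IsOpen Ω) {wk : ℕ → EuclideanSpace ℝ (Fin n) → ℝ}
    {w q : EuclideanSpace ℝ (Fin n) → ℝ} (hwk : ∀ k, ∀ x ∈ Ω, ContDiffAt ℝ 1 (wk k) x)
    (hwc : ContinuousOn w Ω) (hlim : ∀ x ∈ Ω, Tendsto (fun k => wk k x) atTop (nhds (w x)))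
    {M L η : ℝ} (hM : ∀ k, ∀ x ∈ Ω, |wk k x| ≤ M) (hL : 0 ≤ L) (hη : 0 < η) (i : Fin n)
    (hqc : ContinuousOn q Ω)
    (hqL : ∀ x y, segment ℝ x y ⊆ Ω → q x - L * dist x y ≤ q y)
    (hq1 : ∀ x ∈ Ω, 1 + η ≤ q x) {A : ENNReal}
    (hA : ∀ k, ∫⁻ x in Ω, ENNReal.ofReal (|pd (wk k) i x| ^ q x) ≤ A) :
    ∫⁻ x in Ω, ENNReal.ofReal (|pd w i x| ^ q x) ≤
      ENNReal.ofReal (Real.exp (2 * M * L)) * (volume Ω + A) := by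
  set e : EuclideanSpace ℝ (Fin n) := EuclideanSpace.single i 1 with he
  set R := ENNReal.ofReal (Real.exp (2 * M * L)) * (volume Ω + A) with hR
  have hq0 : ∀ x ∈ Ω, 0 < q x := fun x hx => by linarith [hq1 x hx]
  have hcont : ∀ h, 0 < h → ∀ z : EuclideanSpace ℝ (Fin n) → ℝ, ContinuousOn z Ω →
      AEMeasurable (fun x => ENNReal.ofReal (|h⁻¹ * (z (x + h • e) - z x)| ^ q x))
        (volume.restrict (innerSet Ω h)) := by
    intro h hh z hz
    refine (ContinuousOn.aemeasurable ?_ (isOpen_innerSet Ω h).measurableSet).ennreal_ofReal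
    refine continuousOn_abs_rpow (continuousOn_const.mul (ContinuousOn.sub ?_ ?_))
      (hqc.mono innerSet_subset) fun x hx => hq0 x (innerSet_subset hx)
    · exact hz.comp (by fun_prop) fun x hx =>
        add_smul_mem_of_mem_innerSet hx ⟨hh.le, le_rfl⟩ i
    · exact hz.mono innerSet_subset
  have hbound : ∀ h, 0 < h → L * h ≤ η → ∫⁻ x in innerSet Ω h,
      ENNReal.ofReal (|h⁻¹ * (w (x + h • e) - w x)| ^ q x) ≤ R := by
    intro h hh hLh
    have hk : ∀ k, ∫⁻ x in innerSet Ω h,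
        ENNReal.ofReal (|h⁻¹ * (wk k (x + h • e) - wk k x)| ^ q x) ≤ R := by
      intro k
      refine (lintegral_diffQuot_rpow_le hΩo (hwk k) (hM k) hL hh i hqc hqL
        fun x hx => by linarith [hq1 x hx]).trans ?_
      rw [hR]
      gcongr ENNReal.ofReal _ * ?_
      have : ∀ x, ENNReal.ofReal (1 + |pd (wk k) i x| ^ q x) =
          1 + ENNReal.ofReal (|pd (wk k) i x| ^ q x) := fun x => by
        rw [ENNReal.ofReal_add zero_le_one (by positivity), ENNReal.ofReal_one]
      simp only [this]
      rw [lintegral_add_left measurable_const]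
      simp only [lintegral_const, one_mul, Measure.restrict_apply_univ]
      gcongr
      exact hA k
    calc _ = ∫⁻ x in innerSet Ω h, liminf (fun k =>
          ENNReal.ofReal (|h⁻¹ * (wk k (x + h • e) - wk k x)| ^ q x)) atTop := by
          refine setLIntegral_congr_fun (isOpen_innerSet Ω h).measurableSet fun x hx => ?_
          refine (Tendsto.liminf_eq (ENNReal.tendsto_ofReal ?_)).symm
          refine Tendsto.rpow_const ?_ (Or.inr (hq0 x (innerSet_subset hx)).le)
          exact (((hlim _ (add_smul_mem_of_mem_innerSet hx ⟨hh.le, le_rfl⟩ i)).sub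
            (hlim x (innerSet_subset hx))).const_mul _).abs
      _ ≤ liminf (fun k => ∫⁻ x in innerSet Ω h,
          ENNReal.ofReal (|h⁻¹ * (wk k (x + h • e) - wk k x)| ^ q x)) atTop :=
          lintegral_liminf_le' fun k => hcont h hh _
            fun x hx => (hwk k x hx).continuousAt.continuousWithinAt
      _ ≤ R := by
          refine liminf_le_of_le (by isBoundedDefault) fun b hb => ?_
          obtain ⟨k, hk'⟩ := hb.exists
          exact hk'.trans (hk k)
  set h : ℕ → ℝ := fun j => η / (L + 1) * (1 / ((j : ℝ) + 1)) with hh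
  have hpos : ∀ j, 0 < h j := fun j => by positivity
  have hh0 : Tendsto h atTop (nhds 0) := by
    simpa [hh] using tendsto_one_div_add_atTop_nhds_zero_nat.const_mul (η / (L + 1))
  have hsmall : ∀ j, L * h j ≤ η := by
    intro j
    have h1 : 1 / ((j : ℝ) + 1) ≤ 1 := by
      rw [div_le_one (by positivity)]
      linarith [(Nat.cast_nonneg j : (0 : ℝ) ≤ j)]
    have h2 : h j ≤ η / (L + 1) := by
      have : 0 ≤ η / (L + 1) := by positivity
      nlinarith
    have h3 : (L + 1) * (η / (L + 1)) = η := by field_simp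
    nlinarith [hpos j]
  set Φ : ℕ → EuclideanSpace ℝ (Fin n) → ENNReal := fun j => (innerSet Ω (h j)).indicator
    fun x => ENNReal.ofReal (|(h j)⁻¹ * (w (x + h j • e) - w x)| ^ q x) with hΦ
  have hΦlim : ∀ x ∈ Ω, ENNReal.ofReal (|pd w i x| ^ q x) ≤ liminf (fun j => Φ j x) atTop := by
    intro x hx
    by_cases hd : DifferentiableAt ℝ w x
    · refine (Tendsto.liminf_eq ?_).ge
      have h1 : Tendsto (fun j => ENNReal.ofReal (|(h j)⁻¹ * (w (x + h j • e) - w x)| ^ q x))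
          atTop (nhds (ENNReal.ofReal (|pd w i x| ^ q x))) :=
        ENNReal.tendsto_ofReal
          ((tendsto_diffQuot hd i hpos hh0).abs.rpow_const (Or.inr (hq0 x hx).le))
      have h2 : 0 < infEDist x Ωᶜ := by
        rw [infEDist_pos_iff_notMem_closure, hΩo.isClosed_compl.closure_eq]
        simpa using hx
      have h3 : Tendsto (fun j => ENNReal.ofReal (h j)) atTop (nhds 0) := by
        simpa using ENNReal.tendsto_ofReal hh0
      refine h1.congr' ?_
      filter_upwards [h3.eventually_lt_const h2] with j hj
      have hj' : x ∈ innerSet Ω (h j) := hj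
      simp [hΦ, hj']
    · have : pd w i x = 0 := by simp [pd, fderiv_zero_of_not_differentiableAt hd]
      simp [this, Real.zero_rpow (hq0 x hx).ne']
  calc _ ≤ ∫⁻ x in Ω, liminf (fun j => Φ j x) atTop :=
        setLIntegral_mono' hΩo.measurableSet hΦlim
    _ ≤ ∫⁻ x, liminf (fun j => Φ j x) atTop := setLIntegral_le_lintegral _ _
    _ ≤ liminf (fun j => ∫⁻ x, Φ j x) atTop := lintegral_liminf_le' fun j =>
        (aemeasurable_indicator_iff (isOpen_innerSet Ω _).measurableSet).2
          (hcont _ (hpos j) w hwc)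
    _ ≤ R := by
        refine liminf_le_of_le (by isBoundedDefault) fun b hb => ?_
        obtain ⟨j, hj⟩ := hb.exists
        refine hj.trans ?_
        simp only [hΦ]
        rw [lintegral_indicator (isOpen_innerSet Ω _).measurableSet]
        exact hbound _ (hpos j) (hsmall j)

/-- A function of class `C^{1+γ}` on the closure of a bounded open set is uniformly Lipschitz
along the segments contained in the set. -/
lemma C1HolderOn.exists_sub_le {n : ℕ} {Ω : Set (EuclideanSpace ℝ (Fin n))} (hΩo : IsOpen Ω)
    (hΩbd : Bornology.IsBounded Ω) {γ : ℝ} {p : EuclideanSpace ℝ (Fin n) → ℝ}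
    (hp : C1HolderOn γ (closure Ω) p) :
    ∃ L, 0 ≤ L ∧ ∀ x y, segment ℝ x y ⊆ Ω → p x - L * dist x y ≤ p y := by
  obtain ⟨hC1, C, hC⟩ := hp
  have hnhds : ∀ x ∈ Ω, closure Ω ∈ nhds x := fun x hx =>
    mem_of_superset (hΩo.mem_nhds hx) subset_closure
  have hbdd : ∃ L, 0 ≤ L ∧ ∀ x ∈ Ω, ‖fderiv ℝ p x‖ ≤ L := by
    rcases Ω.eq_empty_or_nonempty with rfl | ⟨x₀, hx₀⟩
    · exact ⟨0, le_rfl, by simp⟩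
    · obtain ⟨R, hR⟩ := hΩbd.subset_closedBall x₀
      refine ⟨‖fderiv ℝ p x₀‖ + C * (max R 0) ^ (γ.toNNReal : ℝ), by positivity, fun x hx => ?_⟩
      have h1 := hC.dist_le_of_le (subset_closure hx) (subset_closure hx₀)
        ((mem_closedBall.1 (hR hx)).trans (le_max_left R 0))
      rw [fderivWithin_of_mem_nhds (hnhds x hx), fderivWithin_of_mem_nhds (hnhds x₀ hx₀),
        dist_eq_norm] at h1
      linarith [norm_le_norm_add_norm_sub' (fderiv ℝ p x) (fderiv ℝ p x₀)]
  obtain ⟨L, hL0, hL⟩ := hbdd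
  refine ⟨L, hL0, fun x y hxy => ?_⟩
  have h1 := (convex_segment x y).norm_image_sub_le_of_norm_fderiv_le (𝕜 := ℝ) (f := p) (C := L)
    (fun z hz => (hC1.contDiffAt (hnhds z (hxy hz))).differentiableAt one_ne_zero)
    (fun z hz => hL z (hxy hz)) (right_mem_segment ℝ x y) (left_mem_segment ℝ x y)
  rw [Real.norm_eq_abs, ← dist_eq_norm] at h1
  linarith [(abs_le.1 h1).2]

lemma abs_rpow_add_two_le {g D q P : ℝ} (hg : |g| ≤ D) (hq : 0 ≤ q + 2) (hqP : q ≤ P) :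
    |g| ^ (q + 2) ≤ (1 + D) ^ (P + 2) := by
  have hD : 0 ≤ D := (abs_nonneg g).trans hg
  exact (Real.rpow_le_rpow (abs_nonneg _) (hg.trans (by linarith)) hq).trans
    (Real.rpow_le_rpow_of_exponent_le (by linarith) (by linarith))

/-- Energy estimate for the regularized anisotropic operator on a single time slice. -/
lemma lintegral_pd_rpow_le_of_elliptic {n : ℕ} {Ω : Set (EuclideanSpace ℝ (Fin n))}
    (hΩo : IsOpen Ω) (hΩbd : Bornology.IsBounded Ω)
    {p : Fin n → EuclideanSpace ℝ (Fin n) → ℝ} {w u₀ : EuclideanSpace ℝ (Fin n) → ℝ}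
    {ε M N α : ℝ} {pt C : Fin n → ℝ} (hε : 0 < ε) (hM : 0 ≤ M) (hN : 0 ≤ N)
    (hp : ∀ i, ∀ x ∈ Ω, ContDiffAt ℝ 1 (p i) x) (hp1 : ∀ i, ∀ x ∈ Ω, -1 < p i x)
    (hw : ∀ x ∈ Ω, ContDiffAt ℝ 2 w x) (hu₀ : ∀ x ∈ Ω, ContDiffAt ℝ 1 u₀ x)
    (hvc : ContinuousOn (fun x => w x - u₀ x) (closure Ω))
    (hv0 : ∀ x ∈ frontier Ω, w x - u₀ x = 0) (hvM : ∀ x ∈ Ω, |w x - u₀ x| ≤ M)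
    (hR : ∀ x ∈ Ω,
      |∑ i, pd (fun y => ((pd w i y) ^ 2 + ε) ^ (p i y / 2) * pd w i y) i x| ≤
        N + α * ∑ i, |pd w i x| ^ (pt i + 2))
    (hC0 : ∀ i, 0 ≤ C i)
    (hC : ∀ i, ∀ x ∈ Ω,
      1 / 4 * |pd w i x| ^ (p i x + 2) + M * α * |pd w i x| ^ (pt i + 2) ≤
        ((pd w i x) ^ 2 + ε) ^ (p i x / 2) * pd w i x * (pd w i x - pd u₀ i x) + C i)
    (j : Fin n) {D P : ℝ} (hD : ∀ x ∈ Ω, |pd u₀ j x| ≤ D) (hP : ∀ x ∈ Ω, p j x ≤ P) :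
    ∫⁻ x in Ω, ENNReal.ofReal (|pd w j x| ^ (p j x + 2)) ≤
      4 * (ENNReal.ofReal (∑ i, C i + M * N) * volume Ω) +
        ENNReal.ofReal ((1 + D) ^ (P + 2)) * volume Ω := by
  set v : EuclideanSpace ℝ (Fin n) → ℝ := fun x => w x - u₀ x with hv
  have hw1 : ∀ x ∈ Ω, ContDiffAt ℝ 1 w x := fun x hx => (hw x hx).of_le one_le_two
  have hv1 : ∀ x ∈ Ω, ContDiffAt ℝ 1 v x := fun x hx => (hw1 x hx).sub (hu₀ x hx)
  have hpdv : ∀ i, ∀ x ∈ Ω, pd v i x = pd w i x - pd u₀ i x := by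
    intro i x hx
    have := ((hw1 x hx).differentiableAt one_ne_zero).hasFDerivAt.sub
      ((hu₀ x hx).differentiableAt one_ne_zero).hasFDerivAt
    rw [pd]
    erw [this.fderiv]
    rfl
  have hpdw : ∀ i, ∀ x ∈ Ω, ContDiffAt ℝ 1 (pd w i) x := fun i x hx =>
    ((hw x hx).fderiv_right (m := 1) (by norm_num)).clm_apply contDiffAt_const
  have ha : ∀ i, ∀ x ∈ Ω,
      ContDiffAt ℝ 1 (fun y => ((pd w i y) ^ 2 + ε) ^ (p i y / 2) * pd w i y) x := by
    intro i x hx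
    refine ContDiffAt.mul (ContDiffAt.rpow (((hpdw i x hx).pow 2).add contDiffAt_const)
      ((hp i x hx).div_const 2) ?_) (hpdw i x hx)
    positivity
  have hgc : ContinuousOn (fun x => |pd w j x| ^ (p j x + 2)) Ω :=
    continuousOn_abs_rpow (continuousOn_pd hΩo hw1 j)
      (ContinuousOn.add (fun x hx => (hp j x hx).continuousAt.continuousWithinAt)
        continuousOn_const) fun x hx => by linarith [hp1 j x hx]
  have hMN : 0 ≤ ∑ i, C i + M * N :=
    add_nonneg (Finset.sum_nonneg fun i _ => hC0 i) (mul_nonneg hM hN)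
  have hmain := lintegral_le_of_flux hΩo hΩbd ha hv1 hvc hv0
    (h := fun x => 1 / 4 * |pd w j x| ^ (p j x + 2)) (continuousOn_const.mul hgc)
    (fun x _ => by positivity) hMN (by
      intro x hx
      have h1 : |v x| *
          |∑ i, pd (fun y => ((pd w i y) ^ 2 + ε) ^ (p i y / 2) * pd w i y) i x| ≤
          M * (N + α * ∑ i, |pd w i x| ^ (pt i + 2)) :=
        mul_le_mul (hvM x hx) (hR x hx) (abs_nonneg _) hM
      have h2 := Finset.sum_le_sum fun i (_ : i ∈ Finset.univ) => hC i x hx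
      rw [Finset.sum_add_distrib, Finset.sum_add_distrib, ← Finset.mul_sum, ← Finset.mul_sum]
        at h2
      have h3 : |pd w j x| ^ (p j x + 2) ≤ ∑ i, |pd w i x| ^ (p i x + 2) :=
        Finset.single_le_sum (f := fun i => |pd w i x| ^ (p i x + 2))
          (fun i _ => by positivity) (Finset.mem_univ j)
      have h4 : ∑ i, ((pd w i x) ^ 2 + ε) ^ (p i x / 2) * pd w i x * pd v i x =
          ∑ i, ((pd w i x) ^ 2 + ε) ^ (p i x / 2) * pd w i x * (pd w i x - pd u₀ i x) :=
        Finset.sum_congr rfl fun i _ => by rw [hpdv i x hx]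
      rw [h4]
      linarith)
  have hae := ae_pd_eq_zero_of_eq_zero hΩo
    (fun x hx => (hv1 x hx).differentiableAt one_ne_zero) j
  have hpt : ∀ᵐ x ∂volume.restrict Ω, ENNReal.ofReal (|pd w j x| ^ (p j x + 2)) ≤
      4 * (if v x = 0 then 0 else ENNReal.ofReal (1 / 4 * |pd w j x| ^ (p j x + 2))) +
        ENNReal.ofReal ((1 + D) ^ (P + 2)) := by
    filter_upwards [hae, ae_restrict_mem hΩo.measurableSet] with x hx hxΩ
    split_ifs with h0
    · have h1 : pd w j x = pd u₀ j x := by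
        have := hpdv j x hxΩ
        rw [hx h0] at this
        linarith
      rw [h1, mul_zero, zero_add]
      exact ENNReal.ofReal_le_ofReal (abs_rpow_add_two_le (hD x hxΩ)
        (by linarith [hp1 j x hxΩ]) (hP x hxΩ))
    · have h4 : (4 : ENNReal) = ENNReal.ofReal 4 := by simp
      rw [h4, ← ENNReal.ofReal_mul (by norm_num)]
      refine le_add_right (ENNReal.ofReal_le_ofReal (le_of_eq ?_))
      ring
  refine (lintegral_mono_ae hpt).trans ?_
  rw [lintegral_add_right _ measurable_const, lintegral_const_mul' _ _ (by simp), lintegral_const,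
    Measure.restrict_apply_univ]
  gcongr

/-- Lemma 4.1: uniform-in-ε bound on `∫_Ω |∂_{xᵢ} u_ε|^{pᵢ(x)+2} dx`. -/
theorem stmt10
    (n : ℕ) (hn : 0 < n)
    (Ω : Set (EuclideanSpace ℝ (Fin n)))
    (hΩo : IsOpen Ω) (hΩconn : IsConnected Ω)
    (hΩbd : Bornology.IsBounded Ω) (hΩsph : ExteriorSphereCond Ω)
    (T : ℝ) (hT : 0 < T)
    (γ : ℝ) (hγ : γ ∈ Ioo (0:ℝ) 1)
    (p : Fin n → EuclideanSpace ℝ (Fin n) → ℝ)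
    (hp : ∀ i, C1HolderOn γ (closure Ω) (p i))
    (hp1 : ∀ i, ∀ x ∈ closure Ω, -1 < p i x)
    (ε₀ : ℝ) (hε₀ : 0 < ε₀)
    (ψ u₀ : EuclideanSpace ℝ (Fin n) → ℝ)
    (U : Set (EuclideanSpace ℝ (Fin n))) (hU : IsOpen U) (hUΩ : closure Ω ⊆ U)
    (hu₀ : ContDiffOn ℝ 1 u₀ U)
    (hu₀ψ : ∀ x ∈ frontier Ω, u₀ x = ψ x)
    (M K : ℝ) (hM : 0 < M) (hK : 0 < K)
    (α β : ℝ) (hα : 0 < α) (hβ : 0 < β)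
    (pt : Fin n → ℝ) (hpt : ∀ i, -1 < pt i)
    (hpt2 : ∀ i, ∀ x ∈ closure Ω, pt i < p i x)
    (f : Fin n → EuclideanSpace ℝ (Fin n) → ℝ → ℝ → ℝ)
    (f₀ : EuclideanSpace ℝ (Fin n) → ℝ → ℝ)
    (hf : ∀ i, ∀ x ∈ closure Ω, ∀ v w : ℝ, |f i x v w| ≤ α * |w| ^ (pt i + 2) + β)
    (hf₀c : ContinuousOn (fun q : EuclideanSpace ℝ (Fin n) × ℝ => f₀ q.1 q.2)
      (closure Ω ×ˢ Icc (-M) M))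
    (hf₀b : ∃ Cf : ℝ, ∀ x ∈ closure Ω, ∀ v ∈ Icc (-M) M, |f₀ x v| ≤ Cf) :
    ∃ C : Fin n → ℝ, ∀ ε ∈ Ioc (0:ℝ) ε₀,
      ∀ u : ℝ → EuclideanSpace ℝ (Fin n) → ℝ,
        IsClassicalSolAniso Ω T p
          (fun x v z => (∑ i, f i x v (z i)) + f₀ x v) ψ u₀ ε u →
        (∀ t ∈ Icc 0 T, ∀ x ∈ closure Ω, |u t x| ≤ M) →
        (∀ t ∈ Ioo 0 T, ∀ x ∈ Ω, |deriv (fun s => u s x) t| ≤ K) →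
      ∀ i, ∀ t ∈ Icc 0 T, (∫ x in Ω, |pd (u t) i x| ^ (p i x + 2)) ≤ C i := by
  classical
  have hsub : Ω ⊆ closure Ω := subset_closure
  have hKc : IsCompact (closure Ω) := hΩbd.isCompact_closure
  have hne : (closure Ω).Nonempty := hΩconn.nonempty.mono hsub
  have hvol : volume Ω ≠ ⊤ := hΩbd.measure_lt_top.ne
  have hpc : ∀ i, ContinuousOn (p i) (closure Ω) := fun i => (hp i).1.continuousOn
  have hpΩ : ∀ i, ∀ x ∈ Ω, ContDiffAt ℝ 1 (p i) x := fun i x hx =>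
    (hp i).1.contDiffAt (mem_of_superset (hΩo.mem_nhds hx) hsub)
  have hu₀U : ∀ x ∈ closure Ω, ContDiffAt ℝ 1 u₀ x := fun x hx =>
    hu₀.contDiffAt (hU.mem_nhds (hUΩ hx))
  have hmin : ∀ i, ∃ m, -1 < m ∧ pt i < m ∧ ∀ x ∈ closure Ω, m ≤ p i x := fun i => by
    obtain ⟨x, hx, hmin⟩ := hKc.exists_isMinOn hne (hpc i)
    exact ⟨p i x, hp1 i x hx, hpt2 i x hx, fun y hy => hmin hy⟩
  choose m hm1 hmpt hm using hmin
  have hmax : ∀ i, ∃ P, ∀ x ∈ closure Ω, p i x ≤ P := fun i => by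
    obtain ⟨x, -, hmax⟩ := hKc.exists_isMaxOn hne (hpc i)
    exact ⟨p i x, fun y hy => hmax hy⟩
  choose P hP using hmax
  have hgrad : ∀ i, ∃ D, 0 ≤ D ∧ ∀ x ∈ Ω, |pd u₀ i x| ≤ D := fun i => by
    have h1 : ContinuousOn (pd u₀ i) (closure Ω) :=
      (continuousOn_pd hU (fun x hx => hu₀.contDiffAt (hU.mem_nhds hx)) i).mono hUΩ
    obtain ⟨D, hD⟩ := hKc.exists_bound_of_continuousOn h1
    exact ⟨max D 0, le_max_right _ _, fun x hx => (hD x (hsub hx)).trans (le_max_left _ _)⟩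
  choose D hD0 hD using hgrad
  choose L hL0 hL using fun i => (hp i).exists_sub_le hΩo hΩbd
  choose Cb hCb0 hCb using fun i =>
    exists_flux_bound (ε₀ := ε₀) (P i) (hD0 i) (by positivity : 0 ≤ 2 * M * α) (hpt i) (hmpt i)
  obtain ⟨Cf, hCf⟩ := hf₀b
  set N : ℝ := K + |Cf| + n * β with hN
  set A : Fin n → ENNReal := fun i =>
    4 * (ENNReal.ofReal (∑ i, Cb i + 2 * M * N) * volume Ω) +
      ENNReal.ofReal ((1 + D i) ^ (P i + 2)) * volume Ω with hA
  set R : Fin n → ENNReal := fun i =>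
    ENNReal.ofReal (Real.exp (2 * M * L i)) * (volume Ω + A i) with hR
  have hAtop : ∀ i, A i ≠ ⊤ := fun i => by
    rw [hA]
    finiteness
  have hRtop : ∀ i, R i ≠ ⊤ := fun i => by
    have := hAtop i
    rw [hR]
    finiteness
  have hAR : ∀ i, A i ≤ R i := fun i => by
    have h1 : 1 ≤ ENNReal.ofReal (Real.exp (2 * M * L i)) := by
      rw [ENNReal.one_le_ofReal]
      exact Real.one_le_exp (mul_nonneg (by positivity) (hL0 i))
    calc A i ≤ 1 * (volume Ω + A i) := by
          rw [one_mul]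
          exact le_add_self
      _ ≤ R i := mul_le_mul' h1 le_rfl
  refine ⟨fun i => (R i).toReal, fun ε hε u hu huM huK j t ht => ?_⟩
  have hclosed : ∀ s ∈ Icc 0 T, ContinuousOn (u s) (closure Ω) := fun s hs =>
    hu.cont.comp (f := fun x => (s, x)) (by fun_prop) fun x hx => ⟨hs, hx⟩
  have hslice : ∀ s ∈ Ioo 0 T,
      ∫⁻ x in Ω, ENNReal.ofReal (|pd (u s) j x| ^ (p j x + 2)) ≤ A j := by
    intro s hs
    have hsI : s ∈ Icc 0 T := Ioo_subset_Icc_self hs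
    have h0I : (0 : ℝ) ∈ Icc 0 T := ⟨le_rfl, hT.le⟩
    refine lintegral_pd_rpow_le_of_elliptic (u₀ := u₀) (pt := pt) (α := α) hΩo hΩbd hε.1
      (by positivity) (by positivity) hpΩ (fun i x hx => hp1 i x (hsub hx)) (hu.smooth_x s hs)
      (fun x hx => hu₀U x (hsub hx)) ?_ ?_ ?_ ?_ hCb0 ?_ j (hD j) fun x hx => hP j x (hsub hx)
    · exact (hclosed s hsI).sub fun x hx => (hu₀U x hx).continuousAt.continuousWithinAt
    · intro x hx
      rw [hu.bdry s hs x hx, hu₀ψ x hx, sub_self]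
    · intro x hx
      have h1 := abs_le.1 (huM s hsI x (hsub hx))
      have h2 := abs_le.1 (huM 0 h0I x (hsub hx))
      rw [hu.init x (hsub hx)] at h2
      exact abs_le.2 ⟨by linarith, by linarith⟩
    · intro x hx
      have h1 := hu.eqn s hs x hx
      have h2 := abs_le.1 (huK s hs x hx)
      have h3 : |∑ i, f i x (u s x) (gradv (u s) x i)| ≤
          α * ∑ i, |pd (u s) i x| ^ (pt i + 2) + n * β := by
        refine (Finset.abs_sum_le_sum_abs _ _).trans ?_
        refine (Finset.sum_le_sum fun i _ => hf i x (hsub hx) _ _).trans_eq ?_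
        rw [Finset.sum_add_distrib, ← Finset.mul_sum]
        simp [gradv]
      have h4 : |f₀ x (u s x)| ≤ |Cf| :=
        (hCf x (hsub hx) _ (abs_le.1 (huM s hsI x (hsub hx)))).trans (le_abs_self _)
      have h3' := abs_le.1 h3
      have h4' := abs_le.1 h4
      rw [hN]
      exact abs_le.2 ⟨by linarith, by linarith⟩
    · intro i x hx
      exact hCb i ε hε (p i x) (hm i x (hsub hx)) (hP i x (hsub hx)) _ _ (hD i x hx)
  have hall : ∫⁻ x in Ω, ENNReal.ofReal (|pd (u t) j x| ^ (p j x + 2)) ≤ R j := by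
    rcases ht.1.eq_or_lt with rfl | ht0
    · refine le_trans ?_ (hAR j)
      calc _ ≤ ∫⁻ x in Ω, ENNReal.ofReal ((1 + D j) ^ (P j + 2)) := by
            refine setLIntegral_mono' hΩo.measurableSet fun x hx => ENNReal.ofReal_le_ofReal ?_
            have h1 : u 0 =ᶠ[nhds x] u₀ := by
              filter_upwards [hΩo.mem_nhds hx] with y hy
              exact hu.init y (hsub hy)
            have h2 : pd (u 0) j x = pd u₀ j x := by rw [pd, h1.fderiv_eq, pd]
            rw [h2]
            exact abs_rpow_add_two_le (hD j x hx) (by linarith [hp1 j x (hsub hx)])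
              (hP j x (hsub hx))
        _ ≤ A j := by
            rw [lintegral_const, Measure.restrict_apply_univ]
            exact le_add_self
    rcases ht.2.eq_or_lt with rfl | htT
    · set τ : ℕ → ℝ := fun k => t - t / 2 * (1 / ((k : ℝ) + 1)) with hτ
      have hτI : ∀ k, τ k ∈ Ioo 0 t := fun k => by
        have h1 : 1 / ((k : ℝ) + 1) ≤ 1 := by
          rw [div_le_one (by positivity)]
          linarith [(Nat.cast_nonneg k : (0 : ℝ) ≤ k)]
        have h2 : 0 < 1 / ((k : ℝ) + 1) := by positivity
        constructor
        · simp only [hτ]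
          nlinarith
        · simp only [hτ]
          nlinarith
      have hτlim : Tendsto τ atTop (nhds t) := by
        simpa [hτ] using
          (tendsto_one_div_add_atTop_nhds_zero_nat.const_mul (t / 2)).const_sub t
      refine lintegral_pd_rpow_le_of_tendsto (wk := fun k => u (τ k)) (M := M) (L := L j)
        (η := m j + 1) (q := fun x => p j x + 2) hΩo
        (fun k x hx => (hu.smooth_x _ (hτI k) x hx).of_le one_le_two)
        ((hclosed t ht).mono hsub) (fun x hx => ?_)
        (fun k x hx => huM _ (Ioo_subset_Icc_self (hτI k)) x (hsub hx)) (hL0 j)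
        (by linarith [hm1 j]) j (((hpc j).mono hsub).add continuousOn_const)
        (fun x y hxy => by linarith [hL j x y hxy])
        (fun x hx => by linarith [hm j x (hsub hx)]) fun k => hslice _ (hτI k)
      have h1 : ContinuousWithinAt (fun s => u s x) (Icc 0 t) t :=
        (hu.cont.comp (f := fun s => (s, x)) (by fun_prop) fun s hs => ⟨hs, hsub hx⟩) t ht
      exact h1.tendsto.comp (tendsto_nhdsWithin_iff.2
        ⟨hτlim, Eventually.of_forall fun k => Ioo_subset_Icc_self (hτI k)⟩)
    · exact (hslice t ⟨ht0, htT⟩).trans (hAR j)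
  by_cases hi : Integrable (fun x => |pd (u t) j x| ^ (p j x + 2)) (volume.restrict Ω)
  · have h1 := ofReal_integral_eq_lintegral_ofReal hi (Eventually.of_forall fun x => by positivity)
    exact (ENNReal.ofReal_le_iff_le_toReal (hRtop j)).1 (h1.trans_le hall)
  · rw [integral_undef hi]
    exact ENNReal.toReal_nonneg
end
end
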